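/- Let G = ([n],E) be connected with min degree d_min and max degree d_max, and let Q be the simple random walk on G with spectral gap ξ = 1 − λ_max(Q). Let p be the reversible random walk with p_{ij} ∝ w_j/(w_i+w_j) for (i,j) ∈ E (normalized by d_max) and stationary distribution π_i = w_i/∑_k w_k, where b = max_{i,j} w_i/w_j. Then 1 − λ_max(p) ≥ ξ d_min / (2 b² d_max). -/

import Mathlib

open Matrix Finset

noncomputable def opNorm {m n : ℕ} (A : Matrix (Fin m) (Fin n) ℝ) : ℝ :=
  ‖LinearMap.toContinuousLinearMap (Matrix.toEuclideanLin A)‖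

/-- Second largest eigenvalue modulus of a reversible chain `p` with stationary
distribution `π` (summing to 1). -/
noncomputable def lamMax {n : ℕ} (π : Fin n → ℝ) (p : Matrix (Fin n) (Fin n) ℝ) : ℝ :=
  opNorm (Matrix.of fun i j =>
    Real.sqrt (π i) * p i j / Real.sqrt (π j) - Real.sqrt (π i) * Real.sqrt (π j))

/-- The quadratic form `∑ i j, A i j * x i * x j`. -/
noncomputable def quadForm {n : ℕ} (A : Matrix (Fin n) (Fin n) ℝ) (x : Fin n → ℝ) : ℝ :=
  ∑ i, ∑ j, A i j * x i * x j

lemma reApplyInnerSelf_toEuclideanLin {n : ℕ} (A : Matrix (Fin n) (Fin n) ℝ)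
    (x : EuclideanSpace ℝ (Fin n)) :
    (LinearMap.toContinuousLinearMap (Matrix.toEuclideanLin A)).reApplyInnerSelf x =
      quadForm A x := by
  simp only [ContinuousLinearMap.reApplyInnerSelf_apply, LinearMap.coe_toContinuousLinearMap',
    PiLp.inner_apply, Matrix.ofLp_toLpLin, Matrix.toLin'_apply, Matrix.mulVec, dotProduct,
    RCLike.re_to_real, RCLike.inner_apply, conj_trivial, quadForm, Finset.mul_sum]
  exact Finset.sum_congr rfl fun i _ => Finset.sum_congr rfl fun j _ => by ring

lemma abs_quadForm_le_opNorm {n : ℕ} (A : Matrix (Fin n) (Fin n) ℝ) (x : Fin n → ℝ) :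
    |quadForm A x| ≤ opNorm A * ∑ i, x i ^ 2 := by
  have h := (LinearMap.toContinuousLinearMap (Matrix.toEuclideanLin A)).rayleighQuotient_le_norm
    (WithLp.toLp 2 x)
  rw [ContinuousLinearMap.rayleighQuotient, reApplyInnerSelf_toEuclideanLin, abs_div,
    EuclideanSpace.real_norm_sq_eq] at h
  simp only at h
  have h0 : 0 ≤ ∑ i, x i ^ 2 := Finset.sum_nonneg fun i _ => sq_nonneg _
  rw [abs_of_nonneg h0] at h
  rcases h0.eq_or_lt with h0 | h0
  · have hx : ∀ i, x i = 0 := fun i => by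
      have := (Finset.sum_eq_zero_iff_of_nonneg fun i _ => sq_nonneg (x i)).1 h0.symm i
        (Finset.mem_univ i)
      simpa using this
    simp [quadForm, hx]
  · exact (div_le_iff₀ h0).1 h

lemma opNorm_le_of_abs_quadForm_le {n : ℕ} {A : Matrix (Fin n) (Fin n) ℝ} (hA : A.IsHermitian)
    {r : ℝ} (hr : 0 ≤ r) (h : ∀ x : Fin n → ℝ, |quadForm A x| ≤ r * ∑ i, x i ^ 2) :
    opNorm A ≤ r := by
  have hS : (LinearMap.toContinuousLinearMap (Matrix.toEuclideanLin A)).IsSymmetric :=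
    Matrix.isSymmetric_toEuclideanLin_iff.2 hA
  rw [opNorm, ContinuousLinearMap.norm_eq_iSup_rayleighQuotient _ hS]
  refine ciSup_le fun x => ?_
  rw [ContinuousLinearMap.rayleighQuotient, reApplyInnerSelf_toEuclideanLin, abs_div,
    abs_of_nonneg (sq_nonneg ‖x‖), EuclideanSpace.real_norm_sq_eq]
  exact div_le_of_le_mul₀ (Finset.sum_nonneg fun i _ => sq_nonneg _) hr (h x)

section Kernel

variable {n : ℕ} {s : Matrix (Fin n) (Fin n) ℝ} {m : Fin n → ℝ}

lemma sum_sum_mul_sq_left (hrow : ∀ i, ∑ j, s i j = m i) (f : Fin n → ℝ) :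
    ∑ i, ∑ j, s i j * f i ^ 2 = ∑ i, m i * f i ^ 2 := by
  simp only [← Finset.sum_mul, hrow]

lemma sum_sum_mul_sq_right (hs : ∀ i j, s i j = s j i) (hrow : ∀ i, ∑ j, s i j = m i)
    (f : Fin n → ℝ) : ∑ i, ∑ j, s i j * f j ^ 2 = ∑ i, m i * f i ^ 2 := by
  rw [Finset.sum_comm, ← sum_sum_mul_sq_left hrow]
  exact Finset.sum_congr rfl fun i _ => Finset.sum_congr rfl fun j _ => by rw [hs]

lemma sum_sum_mul_add_smul_sq (hs : ∀ i j, s i j = s j i) (hrow : ∀ i, ∑ j, s i j = m i)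
    (f : Fin n → ℝ) (c : ℝ) :
    ∑ i, ∑ j, s i j * (f i + c * f j) ^ 2 =
      (1 + c ^ 2) * (∑ i, m i * f i ^ 2) + 2 * c * quadForm s f := by
  have : ∀ i j, s i j * (f i + c * f j) ^ 2 =
      s i j * f i ^ 2 + c ^ 2 * (s i j * f j ^ 2) + 2 * c * (s i j * f i * f j) := by
    intros; ring
  simp only [this, Finset.sum_add_distrib, ← Finset.mul_sum, sum_sum_mul_sq_left hrow,
    sum_sum_mul_sq_right hs hrow, quadForm]
  ring

lemma quadForm_sub_const (hs : ∀ i j, s i j = s j i) (hrow : ∀ i, ∑ j, s i j = m i)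
    (f : Fin n → ℝ) (c : ℝ) :
    quadForm s (fun i => f i - c) =
      quadForm s f - 2 * c * (∑ i, m i * f i) + c ^ 2 * ∑ i, m i := by
  have h1 : ∑ i, ∑ j, s i j * f i = ∑ i, m i * f i := by
    simp only [← Finset.sum_mul, hrow]
  have h2 : ∑ i, ∑ j, s i j * f j = ∑ i, m i * f i := by
    rw [Finset.sum_comm, ← h1]
    exact Finset.sum_congr rfl fun i _ => Finset.sum_congr rfl fun j _ => by rw [hs]
  have : ∀ i j, s i j * (f i - c) * (f j - c) =
      s i j * f i * f j - c * (s i j * f i) - c * (s i j * f j) + c ^ 2 * s i j := by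
    intros; ring
  simp only [quadForm, this, Finset.sum_add_distrib, Finset.sum_sub_distrib, ← Finset.mul_sum,
    h1, h2, hrow]
  ring

lemma sum_mul_sub_const_sq (m f : Fin n → ℝ) (c : ℝ) :
    ∑ i, m i * (f i - c) ^ 2 =
      (∑ i, m i * f i ^ 2) - 2 * c * (∑ i, m i * f i) + c ^ 2 * ∑ i, m i := by
  have : ∀ i, m i * (f i - c) ^ 2 = m i * f i ^ 2 - 2 * c * (m i * f i) + c ^ 2 * m i := by
    intros; ring
  simp only [this, Finset.sum_add_distrib, Finset.sum_sub_distrib, ← Finset.mul_sum]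

variable {t : Matrix (Fin n) (Fin n) ℝ} {μ : Fin n → ℝ}

/-- Entrywise domination of symmetric kernels gives domination of the Dirichlet forms
(`c = -1`) and of their sign-changed analogues (`c = 1`). -/
lemma mul_sum_add_mul_quadForm_le (hs : ∀ i j, s i j = s j i) (hrow : ∀ i, ∑ j, s i j = m i)
    (ht : ∀ i j, t i j = t j i) (htrow : ∀ i, ∑ j, t i j = μ i) {a : ℝ}
    (hle : ∀ i j, a * t i j ≤ s i j) (f : Fin n → ℝ) {c : ℝ} (hc : c ^ 2 = 1) :
    a * ((∑ i, μ i * f i ^ 2) + c * quadForm t f) ≤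
      (∑ i, m i * f i ^ 2) + c * quadForm s f := by
  have h : a * ∑ i, ∑ j, t i j * (f i + c * f j) ^ 2 ≤
      ∑ i, ∑ j, s i j * (f i + c * f j) ^ 2 := by
    simp only [Finset.mul_sum]
    refine Finset.sum_le_sum fun i _ => Finset.sum_le_sum fun j _ => ?_
    rw [← mul_assoc]
    exact mul_le_mul_of_nonneg_right (hle i j) (sq_nonneg _)
  rw [sum_sum_mul_add_smul_sq hs hrow, sum_sum_mul_add_smul_sq ht htrow, hc] at h
  linarith

end Kernel

section Reversible

variable {n : ℕ} {π : Fin n → ℝ} {p : Matrix (Fin n) (Fin n) ℝ}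

/-- The symmetric edge-weight kernel `π i * p i j` of a chain. -/
def edgeKernel (π : Fin n → ℝ) (p : Matrix (Fin n) (Fin n) ℝ) : Matrix (Fin n) (Fin n) ℝ :=
  Matrix.of fun i j => π i * p i j

lemma edgeKernel_apply (i j : Fin n) : edgeKernel π p i j = π i * p i j := rfl

lemma sum_edgeKernel (hrow : ∀ i, ∑ j, p i j = 1) (i : Fin n) :
    ∑ j, edgeKernel π p i j = π i := by
  simp only [edgeKernel_apply, ← Finset.mul_sum, hrow, mul_one]

lemma quadForm_lamMax_matrix (hπ : ∀ i, 0 < π i) (f : Fin n → ℝ) :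
    quadForm (Matrix.of fun i j =>
      Real.sqrt (π i) * p i j / Real.sqrt (π j) - Real.sqrt (π i) * Real.sqrt (π j))
      (fun i => Real.sqrt (π i) * f i) =
      quadForm (edgeKernel π p) f - (∑ i, π i * f i) ^ 2 := by
  have h : ∀ i j, (Real.sqrt (π i) * p i j / Real.sqrt (π j) - Real.sqrt (π i) * Real.sqrt (π j))
      * (Real.sqrt (π i) * f i) * (Real.sqrt (π j) * f j) =
      π i * p i j * f i * f j - (π i * f i) * (π j * f j) := by
    intro i j
    have hj := (Real.sqrt_pos.2 (hπ j)).ne'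
    have hi2 := Real.sq_sqrt (hπ i).le
    have hj2 := Real.sq_sqrt (hπ j).le
    generalize Real.sqrt (π i) = u at *
    generalize Real.sqrt (π j) = v at *
    rw [← hi2, ← hj2]
    field_simp
  simp only [quadForm, Matrix.of_apply, h, edgeKernel, Finset.sum_sub_distrib, sq,
    Finset.sum_mul_sum]

lemma sum_sqrt_mul_sq (hπ : ∀ i, 0 < π i) (f : Fin n → ℝ) :
    ∑ i, (Real.sqrt (π i) * f i) ^ 2 = ∑ i, π i * f i ^ 2 :=
  Finset.sum_congr rfl fun i _ => by rw [mul_pow, Real.sq_sqrt (hπ i).le]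

lemma abs_quadForm_edgeKernel_le_lamMax (hπ : ∀ i, 0 < π i) {f : Fin n → ℝ}
    (hf : ∑ i, π i * f i = 0) :
    |quadForm (edgeKernel π p) f| ≤ lamMax π p * ∑ i, π i * f i ^ 2 := by
  have h := abs_quadForm_le_opNorm (Matrix.of fun i j =>
      Real.sqrt (π i) * p i j / Real.sqrt (π j) - Real.sqrt (π i) * Real.sqrt (π j))
      (fun i => Real.sqrt (π i) * f i)
  rwa [quadForm_lamMax_matrix hπ, sum_sqrt_mul_sq hπ, hf, zero_pow two_ne_zero, sub_zero] at h

lemma lamMax_le (hπ : ∀ i, 0 < π i) (hsum : ∑ i, π i = 1) (hrow : ∀ i, ∑ j, p i j = 1)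
    (hrev : ∀ i j, π i * p i j = π j * p j i) {r : ℝ} (hr : 0 ≤ r)
    (h : ∀ f : Fin n → ℝ, ∑ i, π i * f i = 0 →
      |quadForm (edgeKernel π p) f| ≤ r * ∑ i, π i * f i ^ 2) :
    lamMax π p ≤ r := by
  refine opNorm_le_of_abs_quadForm_le ?_ hr fun x => ?_
  · ext i j
    have hi := (Real.sqrt_pos.2 (hπ i)).ne'
    have hj := (Real.sqrt_pos.2 (hπ j)).ne'
    have hi2 := Real.sq_sqrt (hπ i).le
    have hj2 := Real.sq_sqrt (hπ j).le
    have hij := hrev i j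
    simp only [conjTranspose_apply, Matrix.of_apply, star_trivial]
    generalize Real.sqrt (π i) = u at *
    generalize Real.sqrt (π j) = v at *
    rw [← hi2, ← hj2] at hij
    field_simp
    linarith
  · obtain ⟨f, rfl⟩ : ∃ f : Fin n → ℝ, x = fun i => Real.sqrt (π i) * f i :=
      ⟨fun i => x i / Real.sqrt (π i), funext fun i =>
        (mul_div_cancel₀ _ (Real.sqrt_pos.2 (hπ i)).ne').symm⟩
    rw [quadForm_lamMax_matrix hπ, sum_sqrt_mul_sq hπ]
    set c := ∑ i, π i * f i with hc
    have h0 : ∑ i, π i * (f i - c) = 0 := by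
      simp only [mul_sub, Finset.sum_sub_distrib, ← Finset.sum_mul, hsum, ← hc]
      ring
    have h1 := h (fun i => f i - c) h0
    rw [quadForm_sub_const (s := edgeKernel π p) hrev (sum_edgeKernel hrow), sum_mul_sub_const_sq, hsum, ← hc] at h1
    have h2 : quadForm (edgeKernel π p) f - 2 * c * c + c ^ 2 * 1 =
      quadForm (edgeKernel π p) f - c ^ 2 := by ring
    rw [h2] at h1
    refine h1.trans (mul_le_mul_of_nonneg_left ?_ hr)
    nlinarith [sq_nonneg c]

lemma lamMax_nonneg (π : Fin n → ℝ) (p : Matrix (Fin n) (Fin n) ℝ) : 0 ≤ lamMax π p :=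
  norm_nonneg _

lemma lamMax_le_one (hπ : ∀ i, 0 < π i) (hsum : ∑ i, π i = 1) (hrow : ∀ i, ∑ j, p i j = 1)
    (hrev : ∀ i j, π i * p i j = π j * p j i) (hp : ∀ i j, 0 ≤ p i j) :
    lamMax π p ≤ 1 := by
  refine lamMax_le hπ hsum hrow hrev zero_le_one fun f _ => ?_
  have h : ∀ c : ℝ, c ^ 2 = 1 → _ := fun c hc =>
    mul_sum_add_mul_quadForm_le (s := edgeKernel π p) (t := edgeKernel π p) (a := 0)
      hrev (sum_edgeKernel hrow) hrev (sum_edgeKernel hrow)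
      (fun i j => by simpa [edgeKernel] using mul_nonneg (hπ i).le (hp i j)) f (c := c) hc
  have h1 := h 1 (by norm_num)
  have h2 := h (-1) (by norm_num)
  rw [abs_le]
  constructor <;> linarith

/-- Comparison of the spectral gaps of two reversible chains. -/
lemma mul_one_sub_lamMax_le {μ : Fin n → ℝ} {Q : Matrix (Fin n) (Fin n) ℝ}
    (hπ : ∀ i, 0 < π i) (hsum : ∑ i, π i = 1) (hrow : ∀ i, ∑ j, p i j = 1)
    (hrev : ∀ i j, π i * p i j = π j * p j i)
    (hμ : ∀ i, 0 < μ i) (hμsum : ∑ i, μ i = 1) (hQrow : ∀ i, ∑ j, Q i j = 1)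
    (hQrev : ∀ i j, μ i * Q i j = μ j * Q j i) (hgap : lamMax μ Q ≤ 1)
    {a γ : ℝ} (ha : 0 ≤ a) (hγ1 : γ ≤ 1)
    (hle : ∀ i j, a * (μ i * Q i j) ≤ π i * p i j) (hγ : ∀ i, γ * π i ≤ a * μ i) (hγ0 : 0 ≤ γ) :
    γ * (1 - lamMax μ Q) ≤ 1 - lamMax π p := by
  have hL0 := lamMax_nonneg μ Q
  suffices lamMax π p ≤ 1 - γ * (1 - lamMax μ Q) by linarith
  refine lamMax_le hπ hsum hrow hrev (by nlinarith) fun f hf => ?_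
  have hcmp : ∀ c : ℝ, c ^ 2 = 1 → _ := fun c hc =>
    mul_sum_add_mul_quadForm_le (s := edgeKernel π p) (t := edgeKernel μ Q) (a := a)
      hrev (sum_edgeKernel hrow) hQrev (sum_edgeKernel hQrow) hle f (c := c) hc
  have h1 := hcmp 1 (by norm_num)
  have h2 := hcmp (-1) (by norm_num)
  have hmass : ∀ g : Fin n → ℝ, γ * ∑ i, π i * g i ^ 2 ≤ a * ∑ i, μ i * g i ^ 2 := fun g => by
    simp only [Finset.mul_sum, ← mul_assoc]
    exact Finset.sum_le_sum fun i _ => mul_le_mul_of_nonneg_right (hγ i) (sq_nonneg _)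
  set c := ∑ i, μ i * f i with hc
  have h0 : ∑ i, μ i * (f i - c) = 0 := by
    simp only [mul_sub, Finset.sum_sub_distrib, ← Finset.sum_mul, hμsum, ← hc]
    ring
  have hQ := abs_quadForm_edgeKernel_le_lamMax (p := Q) hμ h0
  have hm := hmass f
  have hm' := hmass fun i => f i - c
  simp only [sum_mul_sub_const_sq, hsum, hμsum, ← hc, hf] at hm'
  rw [quadForm_sub_const (s := edgeKernel μ Q) hQrev (sum_edgeKernel hQrow), sum_mul_sub_const_sq, hμsum, ← hc,
    abs_le] at hQ
  generalize quadForm (edgeKernel π p) f = Bp at *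
  generalize quadForm (edgeKernel μ Q) f = BQ at *
  generalize (∑ i, π i * f i ^ 2) = Sp at *
  generalize (∑ i, μ i * f i ^ 2) = SQ at *
  generalize lamMax μ Q = L at *
  have hg : 0 ≤ 1 - L := by linarith
  have hc2 := sq_nonneg c
  rw [abs_le]
  constructor
  · have e1 : (1 - L) * SQ ≤ SQ + BQ := by nlinarith [mul_nonneg hL0 hc2]
    have e2 := mul_le_mul_of_nonneg_left e1 ha
    have e3 := mul_le_mul_of_nonneg_left hm hg
    linarith
  · have e1 : (1 - L) * (SQ - c ^ 2) ≤ SQ - BQ := by nlinarith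
    have e2 := mul_le_mul_of_nonneg_left e1 ha
    have e3 : (1 - L) * (γ * Sp) ≤ (1 - L) * (a * (SQ - c ^ 2)) :=
      mul_le_mul_of_nonneg_left (by nlinarith [mul_nonneg hγ0 hc2]) hg
    linarith

end Reversible

/-- Spectral gap of the ideal RankCentrality random walk: for the reversible walk `p`
with `p_{ij} = (1/d_max)·w_j/(w_i+w_j)` on the edges of a connected graph `G` and
stationary distribution `π_i = w_i/∑_k w_k`, comparing with the simple random walk `Q`
with spectral gap `ξ = 1 − λ_max(Q)` yields `1 − λ_max(p) ≥ ξ d_min/(2 b² d_max)`, where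
`b` bounds the ratios `w_i/w_j`. -/
theorem spectral_gap_ideal_chain {n : ℕ} [NeZero n]
    (G : SimpleGraph (Fin n)) [DecidableRel G.Adj] (hconn : G.Connected)
    (w : Fin n → ℝ) (hw : ∀ i, 0 < w i)
    (b : ℝ) (hb : ∀ i j, w i / w j ≤ b)
    (Q p : Matrix (Fin n) (Fin n) ℝ) (μ π : Fin n → ℝ)
    (hQ : Q = Matrix.of fun i j => if G.Adj i j then ((G.degree i : ℝ))⁻¹ else 0)
    (hμ : μ = fun i => (G.degree i : ℝ) / ∑ k, (G.degree k : ℝ))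
    (hπ : π = fun i => w i / ∑ k, w k)
    (hp : ∀ i j, i ≠ j →
      p i j = if G.Adj i j then (G.maxDegree : ℝ)⁻¹ * (w j / (w i + w j)) else 0)
    (hpd : ∀ i, p i i = 1 - ∑ j ∈ Finset.univ.erase i, p i j)
    (ξ : ℝ) (hξ : ξ = 1 - lamMax μ Q) :
    ξ * (G.minDegree : ℝ) / (2 * b ^ 2 * (G.maxDegree : ℝ)) ≤ 1 - lamMax π p := by
  have hw0 := hw 0
  have hb1 : 1 ≤ b := by simpa [hw0.ne'] using hb 0 0
  have hb0 : 0 < b := by linarith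
  have hbw : ∀ i j, w i ≤ b * w j := fun i j => (div_le_iff₀ (hw j)).1 (hb i j)
  have hW : 0 < ∑ k, w k := Finset.sum_pos (fun i _ => hw i) Finset.univ_nonempty
  have hπpos : ∀ i, 0 < π i := fun i => by rw [hπ]; exact div_pos (hw i) hW
  have hπsum : ∑ i, π i = 1 := by
    simp only [hπ, ← Finset.sum_div]
    exact div_self hW.ne'
  have hprow : ∀ i, ∑ j, p i j = 1 := fun i => by
    rw [← Finset.add_sum_erase _ _ (Finset.mem_univ i), hpd]
    ring
  have hprev : ∀ i j, π i * p i j = π j * p j i := fun i j => by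
    rcases eq_or_ne i j with rfl | hij
    · rfl
    · rw [hp i j hij, hp j i hij.symm, hπ, add_comm (w j)]
      simp only [G.adj_comm j i]
      split_ifs
      · ring
      · simp
  have hpoff : ∀ i j, i ≠ j → 0 ≤ p i j := fun i j hij => by
    have := hw i
    have := hw j
    rw [hp i j hij]
    split_ifs <;> positivity
  have hpdiag : ∀ i, 0 ≤ p i i := fun i => by
    rw [hpd, sub_nonneg]
    have h1 : ∑ j ∈ Finset.univ.erase i, p i j ≤
        ∑ j, if G.Adj i j then (G.maxDegree : ℝ)⁻¹ else 0 := by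
      rw [← Finset.add_sum_erase _ _ (Finset.mem_univ i)]
      simp only [SimpleGraph.irrefl, if_false, zero_add]
      refine Finset.sum_le_sum fun j hj => ?_
      rw [hp i j (Finset.ne_of_mem_erase hj).symm]
      split_ifs
      · refine mul_le_of_le_one_right (by positivity) ?_
        rw [div_le_one (add_pos (hw i) (hw j))]
        linarith [hw i]
      · exact le_rfl
    refine h1.trans ?_
    rw [← Finset.sum_filter, Finset.sum_const, nsmul_eq_mul, ← SimpleGraph.neighborFinset_eq_filter,
      SimpleGraph.card_neighborFinset_eq_degree, ← div_eq_mul_inv]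
    exact div_le_one_of_le₀ (by exact_mod_cast G.degree_le_maxDegree i) (by positivity)
  have hp0 : ∀ i j, 0 ≤ p i j := fun i j => by
    rcases eq_or_ne i j with rfl | hij
    exacts [hpdiag i, hpoff i j hij]
  have hp1 := lamMax_le_one hπpos hπsum hprow hprev hp0
  rcases Nat.eq_zero_or_pos G.minDegree with hmin | hmin
  · simpa [hmin] using hp1
  have hminR : (0 : ℝ) < G.minDegree := by exact_mod_cast hmin
  have hdmin : ∀ i, (G.minDegree : ℝ) ≤ G.degree i := fun i => by
    exact_mod_cast G.minDegree_le_degree i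
  have hd : ∀ i, (0 : ℝ) < G.degree i := fun i => hminR.trans_le (hdmin i)
  have hminmax : (G.minDegree : ℝ) ≤ G.maxDegree :=
    (hdmin 0).trans (by exact_mod_cast G.degree_le_maxDegree 0)
  have hmaxR : (0 : ℝ) < G.maxDegree := hminR.trans_le hminmax
  have hD : 0 < ∑ k, (G.degree k : ℝ) := Finset.sum_pos (fun i _ => hd i) Finset.univ_nonempty
  have hμpos : ∀ i, 0 < μ i := fun i => by rw [hμ]; exact div_pos (hd i) hD
  have hμsum : ∑ i, μ i = 1 := by
    simp only [hμ, ← Finset.sum_div]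
    exact div_self hD.ne'
  have hQrow : ∀ i, ∑ j, Q i j = 1 := fun i => by
    simp only [hQ, Matrix.of_apply]
    rw [← Finset.sum_filter, Finset.sum_const, nsmul_eq_mul, ← SimpleGraph.neighborFinset_eq_filter,
      SimpleGraph.card_neighborFinset_eq_degree, mul_inv_cancel₀ (hd i).ne']
  have hμQ : ∀ i j, μ i * Q i j = if G.Adj i j then (∑ k, (G.degree k : ℝ))⁻¹ else 0 :=
    fun i j => by
      have := (hd i).ne'
      simp only [hQ, hμ, Matrix.of_apply]
      split_ifs
      · field_simp
      · simp
  have hQrev : ∀ i j, μ i * Q i j = μ j * Q j i := fun i j => by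
    simp only [hμQ, G.adj_comm j i]
  have hQ0 : ∀ i j, 0 ≤ Q i j := fun i j => by
    simp only [hQ, Matrix.of_apply]
    split_ifs <;> positivity
  have hQ1 := lamMax_le_one hμpos hμsum hQrow hQrev hQ0
  set D := ∑ k, (G.degree k : ℝ)
  set W := ∑ k, w k
  have key := mul_one_sub_lamMax_le hπpos hπsum hprow hprev hμpos hμsum hQrow hQrev hQ1
    (a := w 0 * D / (2 * b * W * G.maxDegree))
    (γ := G.minDegree / (2 * b ^ 2 * G.maxDegree)) (by positivity) ?_ ?_ ?_ (by positivity)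
  · rw [hξ]
    convert key using 1
    ring
  · rw [div_le_one (by positivity)]
    nlinarith [one_le_pow₀ hb1 (n := 2)]
  · intro i j
    rw [hμQ]
    split_ifs with hij
    · have hi := hw i
      have hj := hw j
      have h1 : w 0 / (2 * b) ≤ w i * w j / (w i + w j) := by
        rw [div_le_div_iff₀ (by positivity) (by positivity)]
        nlinarith [mul_le_mul_of_nonneg_right (hbw 0 i) hj.le,
          mul_le_mul_of_nonneg_right (hbw 0 j) hi.le]
      rw [hp i j hij.ne, if_pos hij, hπ]
      have h2 := mul_le_mul_of_nonneg_right h1 (by positivity : 0 ≤ (W * G.maxDegree)⁻¹)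
      calc _ = _ := by field_simp
      _ ≤ _ := h2
      _ = _ := by field_simp
    · simpa using mul_nonneg (hπpos i).le (hp0 i j)
  · intro i
    simp only [hπ, hμ]
    have h1 : G.minDegree * w i ≤ (G.degree i : ℝ) * (b * w 0) :=
      mul_le_mul (hdmin i) (hbw i 0) (hw i).le (hd i).le
    have h2 := mul_le_mul_of_nonneg_right h1
      (by positivity : 0 ≤ (2 * b ^ 2 * G.maxDegree * W)⁻¹)
    calc _ = _ := by field_simp
      _ ≤ _ := h2
      _ = _ := by field_simp
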